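/- Let R be a commutative ring. Then the polynomial ring R[x] is a UWNC ring if and only if R is a UWNC ring. -/

import Mathlib

/-- An element of a ring is *weakly nil-clean* if it is `e + n` or `-e + n`
for an idempotent `e` and a nilpotent `n`. -/
def IsWeaklyNilClean {R : Type*} [Ring R] (a : R) : Prop :=
  ∃ e n : R, IsIdempotentElem e ∧ IsNilpotent n ∧ (a = e + n ∨ a = -e + n)

/-- An element of a ring is *nil-clean* if it is `e + n`
for an idempotent `e` and a nilpotent `n`. -/
def IsNilClean {R : Type*} [Ring R] (a : R) : Prop :=
  ∃ e n : R, IsIdempotentElem e ∧ IsNilpotent n ∧ a = e + n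

/-- A ring is *UWNC* if every unit is weakly nil-clean. -/
def IsUWNC (R : Type*) [Ring R] : Prop :=
  ∀ u : Rˣ, IsWeaklyNilClean (u : R)

/-- A ring is *UNC* if every unit is nil-clean. -/
def IsUNC (R : Type*) [Ring R] : Prop :=
  ∀ u : Rˣ, IsNilClean (u : R)

/-- A ring is *WUU* if every unit is of the form `n + 1` or `n - 1`
for a nilpotent `n`. -/
def IsWUU (R : Type*) [Ring R] : Prop :=
  ∀ u : Rˣ, ∃ n : R, IsNilpotent n ∧ ((u : R) = n + 1 ∨ (u : R) = n - 1)

theorem IsWeaklyNilClean.map {R S : Type*} [Ring R] [Ring S] (f : R →+* S) {a : R}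
    (ha : IsWeaklyNilClean a) : IsWeaklyNilClean (f a) := by
  obtain ⟨e, n, he, hn, h⟩ := ha
  refine ⟨f e, f n, he.map f, hn.map f, ?_⟩
  rcases h with rfl | rfl <;> simp

theorem IsWeaklyNilClean.add_isNilpotent {R : Type*} [CommRing R] {a b : R}
    (ha : IsWeaklyNilClean a) (hb : IsNilpotent b) : IsWeaklyNilClean (a + b) := by
  obtain ⟨e, n, he, hn, h⟩ := ha
  refine ⟨e, n + b, he, (Commute.all n b).isNilpotent_add hn hb, ?_⟩
  rcases h with rfl | rfl <;> simp [add_assoc]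

theorem Polynomial.isNilpotent_sub_C_coeff_zero_of_isUnit {R : Type*} [CommRing R]
    {p : Polynomial R} (hp : IsUnit p) : IsNilpotent (p - Polynomial.C (p.coeff 0)) := by
  rw [Polynomial.isNilpotent_iff]
  intro i
  by_cases hi : i = 0
  · simp [hi]
  · simpa [Polynomial.coeff_C, hi] using
      (Polynomial.coeff_isUnit_isNilpotent_of_isUnit hp).2 i hi

theorem polynomial_isUWNC_iff {R : Type*} [CommRing R] :
    IsUWNC (Polynomial R) ↔ IsUWNC R := by
  constructor
  · intro h u
    simpa using (h (Units.map Polynomial.C.toMonoidHom u)).map Polynomial.constantCoeff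
  · intro h p
    obtain ⟨v, hv⟩ := (Polynomial.coeff_isUnit_isNilpotent_of_isUnit p.isUnit).1
    have hc := (h v).map Polynomial.C
    rw [hv] at hc
    simpa using
      hc.add_isNilpotent (Polynomial.isNilpotent_sub_C_coeff_zero_of_isUnit p.isUnit)
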